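/- Classification of conformal Killing vectors of flat space: let n ≥ 3 and let λ_μ : ℝ^n → ℝ (μ = 0,…,n−1) and λ : ℝ^n → ℝ be smooth functions satisfying the conformal Killing equation ∂_ν λ_μ + ∂_μ λ_ν = 2η_{μν} λ everywhere on ℝ^n. Then there exist constants a_μ, f, b_μ and constants ω_{μν} with ω_{μν} = −ω_{νμ} such that for all x ∈ ℝ^n: λ_μ(x) = a_μ + ω_{μν} x^ν + f x_μ + b_μ (x·x) − 2 (b·x) x_μ and λ(x) = f − 2 (b·x), where x_μ = η_{μν} x^ν, x·x = η_{μν} x^μ x^ν, and b·x = b_μ x^μ. (The parameters ω_{μν}, a_μ, f, b_μ describe infinitesimal Lorentz transformations, translations, dilations, and special conformal transformations, respectively.) -/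

import Mathlib

noncomputable section

open MeasureTheory

/-- Minkowski metric `diag(-1,1,…,1)` on `Fin n`. -/
def eta (n : ℕ) (μ ν : Fin n) : ℝ :=
  if μ = ν then (if (μ : ℕ) = 0 then -1 else 1) else 0

/-- Partial derivative in the coordinate direction `μ`. -/
def pd {n : ℕ} (μ : Fin n) (f : (Fin n → ℝ) → ℝ) : (Fin n → ℝ) → ℝ :=
  fun x => fderiv ℝ f x (Pi.single μ 1)

/-- A rank-2 covariant field on `ℝ^n`. -/
abbrev TensorField (n : ℕ) := Fin n → Fin n → (Fin n → ℝ) → ℝ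

/-- Linearized Riemann tensor
`ℛ_{αβγδ}[h] = −(1/2)(∂_α∂_γ h_{βδ} + ∂_β∂_δ h_{αγ} − ∂_α∂_δ h_{βγ} − ∂_β∂_γ h_{αδ})`. -/
def Riem {n : ℕ} (h : TensorField n) (α β γ δ : Fin n) : (Fin n → ℝ) → ℝ :=
  fun x => -(1/2) * (pd α (pd γ (h β δ)) x + pd β (pd δ (h α γ)) x
    - pd α (pd δ (h β γ)) x - pd β (pd γ (h α δ)) x)

/-- Linearized Ricci tensor
`ℛ_{μν}[h] = (1/2) η^{αλ}(∂_μ∂_α h_{λν} − ∂_λ∂_α h_{μν} − ∂_μ∂_ν h_{λα} + ∂_λ∂_ν h_{μα})`. -/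
def Ricci {n : ℕ} (h : TensorField n) (μ ν : Fin n) : (Fin n → ℝ) → ℝ :=
  fun x => (1/2) * ∑ α, ∑ l, eta n α l *
    (pd μ (pd α (h l ν)) x - pd l (pd α (h μ ν)) x
      - pd μ (pd ν (h l α)) x + pd l (pd ν (h μ α)) x)

/-- Linearized scalar curvature `ℛ[h] = η^{αλ}η^{μν}(∂_λ∂_ν h_{μα} − ∂_α∂_λ h_{μν})`. -/
def Scal {n : ℕ} (h : TensorField n) : (Fin n → ℝ) → ℝ :=
  fun x => ∑ α, ∑ l, ∑ μ, ∑ ν, eta n α l * eta n μ ν *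
    (pd l (pd ν (h μ α)) x - pd α (pd l (h μ ν)) x)

/-- Linearized Schouten-type tensor
`𝒦_{μν}[h] = (1/(n−2))(ℛ_{μν}[h] − η_{μν}ℛ[h]/(2(n−1)))`. -/
def Kt {n : ℕ} (h : TensorField n) (μ ν : Fin n) : (Fin n → ℝ) → ℝ :=
  fun x => (1 / ((n : ℝ) - 2)) *
    (Ricci h μ ν x - eta n μ ν * Scal h x / (2 * ((n : ℝ) - 1)))

/-- Linearized Weyl tensor
`𝒲_{αβγδ}[h] = ℛ_{αβγδ}[h] − η_{αγ}𝒦_{δβ}[h] + η_{αδ}𝒦_{γβ}[h] + η_{βγ}𝒦_{δα}[h] − η_{βδ}𝒦_{γα}[h]`. -/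
def Weyl {n : ℕ} (h : TensorField n) (α β γ δ : Fin n) : (Fin n → ℝ) → ℝ :=
  fun x => Riem h α β γ δ x - eta n α γ * Kt h δ β x + eta n α δ * Kt h γ β x
    + eta n β γ * Kt h δ α x - eta n β δ * Kt h γ α x

/-- Linearized Cotton tensor `𝒞_{αβμ}[h] = ∂_μ𝒦_{βα}[h] − ∂_β𝒦_{μα}[h]`. -/
def Cotton {n : ℕ} (h : TensorField n) (α β μ : Fin n) : (Fin n → ℝ) → ℝ :=
  fun x => pd μ (Kt h β α) x - pd β (Kt h μ α) x

/-- Cotton tensor with all indices raised: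
`𝒞^{αβρ}[h] = η^{αα'}η^{ββ'}η^{ρρ'}𝒞_{α'β'ρ'}[h]`. -/
def CottonUp {n : ℕ} (h : TensorField n) (α β ρ : Fin n) : (Fin n → ℝ) → ℝ :=
  fun x => ∑ α', ∑ β', ∑ ρ', eta n α α' * eta n β β' * eta n ρ ρ' * Cotton h α' β' ρ' x

/-- Linearized Bach tensor `ℬ^{αβ}[h] = −2∂_ρ𝒞^{αβρ}[h]`. -/
def Bach {n : ℕ} (h : TensorField n) (α β : Fin n) : (Fin n → ℝ) → ℝ :=
  fun x => -2 * ∑ ρ, pd ρ (CottonUp h α β ρ) x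

theorem ContDiff.pd {n : ℕ} {f : (Fin n → ℝ) → ℝ} (hf : ContDiff ℝ (⊤ : ℕ∞) f) (μ : Fin n) :
    ContDiff ℝ (⊤ : ℕ∞) (pd μ f) :=
  (hf.fderiv_right (m := (⊤ : ℕ∞)) (by simp)).clm_apply contDiff_const

/-- Partial derivatives of a smooth function commute. -/
theorem pd_comm {n : ℕ} {f : (Fin n → ℝ) → ℝ} (hf : ContDiff ℝ (⊤ : ℕ∞) f) (μ ν : Fin n)
    (x : Fin n → ℝ) : pd μ (pd ν f) x = pd ν (pd μ f) x := by
  have hsymm : IsSymmSndFDerivAt ℝ f x :=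
    hf.contDiffAt.isSymmSndFDerivAt (by
      rw [minSmoothness_of_isRCLikeNormedField]
      exact WithTop.coe_le_coe.2 (le_top : (2 : ℕ∞) ≤ ⊤))
  have hd : DifferentiableAt ℝ (fderiv ℝ f) x :=
    ((hf.fderiv_right (m := (⊤ : ℕ∞)) (by simp)).differentiable (by simp)) x
  have key : ∀ α β : Fin n,
      pd α (pd β f) x = fderiv ℝ (fderiv ℝ f) x (Pi.single α 1) (Pi.single β 1) := by
    intro α β
    unfold pd
    rw [fderiv_clm_apply hd (differentiableAt_const _)]
    simp
  rw [key, key]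
  exact hsymm _ _

theorem pd_add {n : ℕ} {f g : (Fin n → ℝ) → ℝ} (hf : Differentiable ℝ f)
    (hg : Differentiable ℝ g) (μ : Fin n) (x : Fin n → ℝ) :
    pd μ (fun y => f y + g y) x = pd μ f x + pd μ g x := by
  simp [pd, fderiv_fun_add (hf x) (hg x)]

theorem pd_sub {n : ℕ} {f g : (Fin n → ℝ) → ℝ} (hf : Differentiable ℝ f)
    (hg : Differentiable ℝ g) (μ : Fin n) (x : Fin n → ℝ) :
    pd μ (fun y => f y - g y) x = pd μ f x - pd μ g x := by
  simp [pd, fderiv_fun_sub (hf x) (hg x)]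

theorem pd_const_mul {n : ℕ} {f : (Fin n → ℝ) → ℝ} (hf : Differentiable ℝ f) (c : ℝ)
    (μ : Fin n) (x : Fin n → ℝ) : pd μ (fun y => c * f y) x = c * pd μ f x := by
  simp [pd, fderiv_const_mul (hf x)]

theorem fderiv_eq_sum_pd {n : ℕ} (f : (Fin n → ℝ) → ℝ) (x v : Fin n → ℝ) :
    fderiv ℝ f x v = ∑ ν, v ν * pd ν f x := by
  conv_lhs => rw [pi_eq_sum_univ' v]
  simp [pd, map_sum]

theorem hasDerivAt_comp_ray {n : ℕ} {f : (Fin n → ℝ) → ℝ} (hf : Differentiable ℝ f)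
    (x : Fin n → ℝ) (t : ℝ) :
    HasDerivAt (fun s : ℝ => f (s • x)) (∑ ν, x ν * pd ν f (t • x)) t := by
  have hray : HasDerivAt (fun s : ℝ => s • x) x t := by
    simpa using (hasDerivAt_id t).smul_const x
  have h := (hf (t • x)).hasFDerivAt.comp_hasDerivAt t hray
  rwa [fderiv_eq_sum_pd] at h

/-- A function with constant partial derivatives is affine. -/
theorem eq_affine_of_pd_const {n : ℕ} {f : (Fin n → ℝ) → ℝ} (hf : Differentiable ℝ f)
    {c : Fin n → ℝ} (hc : ∀ ν x, pd ν f x = c ν) (x : Fin n → ℝ) :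
    f x = f 0 + ∑ ν, x ν * c ν := by
  have hd : ∀ t : ℝ, HasDerivAt (fun s : ℝ => f (s • x) - s * ∑ ν, x ν * c ν) 0 t := by
    intro t
    have h := (hasDerivAt_comp_ray hf x t).sub ((hasDerivAt_id t).mul_const (∑ ν, x ν * c ν))
    exact h.congr_deriv (by simp [hc])
  have h := is_const_of_deriv_eq_zero (fun t => (hd t).differentiableAt)
    (fun t => (hd t).deriv) 1 0
  simp only [one_smul, zero_smul, one_mul, zero_mul] at h
  linarith

/-- A function with constant second partial derivatives is a quadratic polynomial. -/
theorem eq_quadratic_of_pd_pd_const {n : ℕ} {f : (Fin n → ℝ) → ℝ}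
    (hf : ContDiff ℝ (⊤ : ℕ∞) f) {c : Fin n → Fin n → ℝ}
    (hc : ∀ ρ ν x, pd ρ (pd ν f) x = c ρ ν) (x : Fin n → ℝ) :
    f x = f 0 + ∑ ν, x ν * pd ν f 0 + (1 / 2) * ∑ ν, ∑ ρ, x ν * x ρ * c ρ ν := by
  set A := ∑ ν, x ν * pd ν f 0 with hA
  set B := ∑ ν, ∑ ρ, x ν * x ρ * c ρ ν with hB
  have hpd : ∀ t : ℝ, ∑ ν, x ν * pd ν f (t • x) = A + t * B := by
    intro t
    rw [hA, hB, Finset.mul_sum, ← Finset.sum_add_distrib]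
    refine Finset.sum_congr rfl fun ν _ => ?_
    rw [eq_affine_of_pd_const ((hf.pd ν).differentiable (by simp)) (fun ρ y => hc ρ ν y) (t • x),
      mul_add, Finset.mul_sum, Finset.mul_sum]
    congr 1
    refine Finset.sum_congr rfl fun ρ _ => ?_
    simp only [Pi.smul_apply, smul_eq_mul]
    ring
  have hd : ∀ t : ℝ, HasDerivAt (fun s : ℝ => f (s • x) - (s * A + s ^ 2 * (B / 2))) 0 t := by
    intro t
    have h := (hasDerivAt_comp_ray (hf.differentiable (by simp)) x t).sub
      (((hasDerivAt_id t).mul_const A).add ((hasDerivAt_pow 2 t).mul_const (B / 2)))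
    rw [hpd] at h
    refine h.congr_deriv ?_
    norm_num
    ring
  have h := is_const_of_deriv_eq_zero (fun t => (hd t).differentiableAt)
    (fun t => (hd t).deriv) 1 0
  simp only [one_smul, zero_smul, one_mul, zero_mul, one_pow, ne_eq, OfNat.ofNat_ne_zero,
    not_false_eq_true, zero_pow] at h
  linarith

theorem eta_comm {n : ℕ} (μ ν : Fin n) : eta n μ ν = eta n ν μ := by
  unfold eta
  by_cases h : μ = ν
  · subst h; rfl
  · rw [if_neg h, if_neg (Ne.symm h)]

theorem eta_of_ne {n : ℕ} {μ ν : Fin n} (h : μ ≠ ν) : eta n μ ν = 0 := if_neg h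

theorem eta_self_mul_self {n : ℕ} (μ : Fin n) : eta n μ μ * eta n μ μ = 1 := by
  unfold eta
  by_cases h : (μ : ℕ) = 0 <;> simp [h]

/-- In dimension at least three, the integrability condition of the conformal Killing equation
forces the Hessian of the conformal factor to vanish. -/
theorem eq_zero_of_eta_mul_antisymm {n : ℕ} (hn : 3 ≤ n) {H : Fin n → Fin n → ℝ}
    (hH : ∀ μ ν ρ σ, eta n μ ρ * H σ ν - eta n ν ρ * H σ μ
      = eta n μ σ * H ρ ν - eta n ν σ * H ρ μ) (μ ν : Fin n) : H μ ν = 0 := by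
  have third : ∀ α β : Fin n, ∃ γ, γ ≠ α ∧ γ ≠ β := by
    intro α β
    have hcard : ({α, β} : Finset (Fin n)).card < (Finset.univ : Finset (Fin n)).card := by
      have := Finset.card_le_two (a := α) (b := β)
      simp only [Finset.card_univ, Fintype.card_fin]
      omega
    obtain ⟨γ, -, hγ⟩ := Finset.exists_mem_notMem_of_card_lt_card hcard
    simp only [Finset.mem_insert, Finset.mem_singleton, not_or] at hγ
    exact ⟨γ, hγ⟩
  have key : ∀ α β γ, α ≠ β → α ≠ γ → eta n α α * H β γ = -(eta n γ β * H α α) := by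
    intro α β γ hβ hγ
    have h := hH α γ α β
    rw [eta_of_ne hβ, eta_of_ne hγ.symm] at h
    linarith
  have hne : ∀ α, eta n α α ≠ 0 := fun α h => by
    have := eta_self_mul_self α
    simp [h] at this
  by_cases h : μ = ν
  · subst h
    have flip : ∀ α β, α ≠ β → eta n β β * H β β = -(eta n α α * H α α) := by
      intro α β hαβ
      have h := key α β β hαβ hαβ
      linear_combination (eta n α α * eta n β β) * h
        - eta n β β * H β β * eta_self_mul_self α
        - eta n α α * H α α * eta_self_mul_self β
    obtain ⟨α, hα, -⟩ := third μ μ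
    obtain ⟨β, hβμ, hβα⟩ := third μ α
    have h1 := flip α μ hα
    have h2 := flip β μ hβμ
    have h3 := flip β α hβα
    exact (mul_eq_zero.mp (by linarith : eta n μ μ * H μ μ = 0)).resolve_left (hne μ)
  · obtain ⟨α, hαμ, hαν⟩ := third μ ν
    have h' := key α μ ν hαμ hαν
    rw [eta_of_ne (Ne.symm h), zero_mul, neg_zero] at h'
    exact (mul_eq_zero.mp h').resolve_left (hne α)

section ConformalKilling

variable {n : ℕ} {lam : Fin n → (Fin n → ℝ) → ℝ} {lam0 : (Fin n → ℝ) → ℝ}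

/-- The second derivatives of a conformal Killing field are determined by the gradient of the
conformal factor. -/
theorem pd_pd_conformalKilling
    (hlam : ∀ μ, ContDiff ℝ (⊤ : ℕ∞) (lam μ)) (hlam0 : ContDiff ℝ (⊤ : ℕ∞) lam0)
    (hck : ∀ (μ ν : Fin n) (x : Fin n → ℝ),
      pd ν (lam μ) x + pd μ (lam ν) x = 2 * eta n μ ν * lam0 x)
    (ρ ν μ : Fin n) (x : Fin n → ℝ) :
    pd ρ (pd ν (lam μ)) x
      = eta n μ ν * pd ρ lam0 x + eta n μ ρ * pd ν lam0 x - eta n ν ρ * pd μ lam0 x := by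
  have hdiff : ∀ α β, Differentiable ℝ (pd α (lam β)) := fun α β =>
    ((hlam β).pd α).differentiable (by simp)
  have hD : ∀ α β γ : Fin n, pd γ (pd β (lam α)) x + pd γ (pd α (lam β)) x
      = 2 * eta n α β * pd γ lam0 x := by
    intro α β γ
    rw [← pd_add (hdiff β α) (hdiff α β), funext (hck α β),
      pd_const_mul (hlam0.differentiable (by simp))]
  have h1 := hD μ ν ρ
  have h2 := hD μ ρ ν
  have h3 := hD ν ρ μ
  have c1 := pd_comm (hlam μ) ρ ν x
  have c2 := pd_comm (hlam ν) ρ μ x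
  have c3 := pd_comm (hlam ρ) ν μ x
  linarith

theorem pd_pd_conformalFactor_eq_zero (hn : 3 ≤ n)
    (hlam : ∀ μ, ContDiff ℝ (⊤ : ℕ∞) (lam μ)) (hlam0 : ContDiff ℝ (⊤ : ℕ∞) lam0)
    (hck : ∀ (μ ν : Fin n) (x : Fin n → ℝ),
      pd ν (lam μ) x + pd μ (lam ν) x = 2 * eta n μ ν * lam0 x)
    (α β : Fin n) (x : Fin n → ℝ) : pd α (pd β lam0) x = 0 := by
  refine eq_zero_of_eta_mul_antisymm hn (H := fun α β => pd α (pd β lam0) x) ?_ α β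
  intro μ ν ρ σ
  have hdiff : ∀ γ, Differentiable ℝ (pd γ lam0) := fun γ =>
    (hlam0.pd γ).differentiable (by simp)
  have third : ∀ τ κ : Fin n, pd τ (pd κ (pd ν (lam μ))) x
      = eta n μ ν * pd τ (pd κ lam0) x + eta n μ κ * pd τ (pd ν lam0) x
        - eta n ν κ * pd τ (pd μ lam0) x := by
    intro τ κ
    rw [funext (pd_pd_conformalKilling hlam hlam0 hck κ ν μ),
      pd_sub (((hdiff κ).const_mul _).fun_add ((hdiff ν).const_mul _)) ((hdiff μ).const_mul _),
      pd_add ((hdiff κ).const_mul _) ((hdiff ν).const_mul _),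
      pd_const_mul (hdiff κ), pd_const_mul (hdiff ν), pd_const_mul (hdiff μ)]
  have h1 := third σ ρ
  have h2 := third ρ σ
  have c1 := pd_comm ((hlam μ).pd ν) σ ρ x
  have c2 := pd_comm hlam0 σ ρ x
  rw [c2] at h1
  linarith

end ConformalKilling

/-- classification of conformal Killing vectors of flat space:
`λ_μ(x) = a_μ + ω_{μν} x^ν + f x_μ + b_μ (x·x) − 2 (b·x) x_μ` and
`λ(x) = f − 2 (b·x)`, with `ω_{μν}` antisymmetric. -/
theorem conformal_killing_classification {n : ℕ} (hn : 3 ≤ n)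
    (lam : Fin n → (Fin n → ℝ) → ℝ) (lam0 : (Fin n → ℝ) → ℝ)
    (hlam : ∀ μ, ContDiff ℝ (⊤ : ℕ∞) (lam μ)) (hlam0 : ContDiff ℝ (⊤ : ℕ∞) lam0)
    (hck : ∀ (μ ν : Fin n) (x : Fin n → ℝ),
      pd ν (lam μ) x + pd μ (lam ν) x = 2 * eta n μ ν * lam0 x) :
    ∃ (a : Fin n → ℝ) (f : ℝ) (b : Fin n → ℝ) (ω : Fin n → Fin n → ℝ),
      (∀ μ ν, ω μ ν = -ω ν μ) ∧
      (∀ (x : Fin n → ℝ) (μ : Fin n),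
        lam μ x = a μ + (∑ ν, ω μ ν * x ν) + f * (∑ ν, eta n μ ν * x ν)
          + b μ * (∑ ρ, ∑ σ, eta n ρ σ * x ρ * x σ)
          - 2 * (∑ ρ, b ρ * x ρ) * (∑ ν, eta n μ ν * x ν)) ∧
      (∀ (x : Fin n → ℝ), lam0 x = f - 2 * ∑ ρ, b ρ * x ρ) := by
  have hgrad : ∀ ν x, pd ν lam0 x = pd ν lam0 0 := fun ν x => by
    simpa using eq_affine_of_pd_const ((hlam0.pd ν).differentiable (by simp)) (c := 0)
      (fun α y => pd_pd_conformalFactor_eq_zero hn hlam hlam0 hck α ν y) x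
  refine ⟨fun μ => lam μ 0, lam0 0, fun μ => -(1 / 2) * pd μ lam0 0,
    fun μ ν => pd ν (lam μ) 0 - lam0 0 * eta n μ ν, ?_, ?_, ?_⟩
  · intro μ ν
    have h := hck μ ν 0
    simp only [eta_comm ν μ]
    linarith
  · intro x μ
    rw [eq_quadratic_of_pd_pd_const (hlam μ) (c := fun ρ ν => eta n μ ν * pd ρ lam0 0
      + eta n μ ρ * pd ν lam0 0 - eta n ν ρ * pd μ lam0 0) (fun ρ ν y => by
        rw [pd_pd_conformalKilling hlam hlam0 hck, hgrad ρ, hgrad ν, hgrad μ]) x]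
    have hlin : ∑ ν, (pd ν (lam μ) 0 - lam0 0 * eta n μ ν) * x ν
        = ∑ ν, x ν * pd ν (lam μ) 0 - lam0 0 * ∑ ν, eta n μ ν * x ν := by
      rw [Finset.mul_sum, ← Finset.sum_sub_distrib]
      exact Finset.sum_congr rfl fun ν _ => by ring
    have hb : ∑ ρ, -(1 / 2) * pd ρ lam0 0 * x ρ = -(1 / 2) * ∑ ρ, x ρ * pd ρ lam0 0 := by
      rw [Finset.mul_sum]
      exact Finset.sum_congr rfl fun ρ _ => by ring
    have hquad : ∑ ν, ∑ ρ, x ν * x ρ * (eta n μ ν * pd ρ lam0 0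
          + eta n μ ρ * pd ν lam0 0 - eta n ν ρ * pd μ lam0 0)
        = (∑ ν, eta n μ ν * x ν) * (∑ ρ, x ρ * pd ρ lam0 0)
          + (∑ ν, x ν * pd ν lam0 0) * (∑ ρ, eta n μ ρ * x ρ)
          - pd μ lam0 0 * ∑ ρ, ∑ σ, eta n ρ σ * x ρ * x σ := by
      rw [Finset.sum_mul_sum, Finset.sum_mul_sum, Finset.mul_sum, ← Finset.sum_add_distrib,
        ← Finset.sum_sub_distrib]
      refine Finset.sum_congr rfl fun ν _ => ?_
      rw [Finset.mul_sum, ← Finset.sum_add_distrib, ← Finset.sum_sub_distrib]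
      exact Finset.sum_congr rfl fun ρ _ => by ring
    rw [hlin, hb, hquad]
    ring
  · intro x
    rw [eq_affine_of_pd_const (hlam0.differentiable (by simp)) hgrad x, sub_eq_add_neg,
      Finset.mul_sum, ← Finset.sum_neg_distrib]
    congr 1
    exact Finset.sum_congr rfl fun ν _ => by ring
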